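/- Let Γ be a countable non-amenable group and T a probability-measure-preserving action of Γ on a standard probability space (X,μ). Then the naive entropy h^{naive}_μ(T) is either 0 or +∞. More precisely, if there exists a finite-Shannon-entropy partition 𝒫 of X with h^{naive}_μ(T,𝒫) > 0, then h^{naive}_μ(T) = +∞. -/

import Mathlib

open MeasureTheory Filter
open scoped ENNReal Pointwise

/-- Shannon entropy (with values in `ℝ≥0∞`) of the countable measurable partition of `X`
given by the fibers of `f : X → ι`. -/
noncomputable def Hent {X : Type*} [MeasurableSpace X] (μ : Measure X)
    {ι : Type*} [Countable ι] (f : X → ι) : ℝ≥0∞ :=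
  ∑' i : ι, ENNReal.ofReal (Real.negMulLog (μ (f ⁻¹' {i})).toReal)

/-- The naive entropy `h^{naive}_μ(T,f) = inf_W |W|⁻¹ H_μ(⋁_{w ∈ W} (T^w)⁻¹ f)` of a
pmp action `T` of `Γ` with respect to the partition `f`, the infimum running over all
nonempty finite subsets `W ⊆ Γ`. -/
noncomputable def naiveEntPart {Γ : Type*} [Group Γ] {X : Type*} [MeasurableSpace X]
    (μ : Measure X) (T : Γ → X → X) {ι : Type*} [Countable ι] (f : X → ι) : ℝ≥0∞ :=
  ⨅ W : {W : Finset Γ // W.Nonempty},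
    Hent μ (fun x (w : (W : Finset Γ)) => f (T (w : Γ) x)) / ((W : Finset Γ).card : ℝ≥0∞)

open Real in
/-- Gibbs' inequality, pointwise form. -/
lemma negMulLog_le_of_le_marginals {p a b : ℝ} (hp : 0 ≤ p) (hpa : p ≤ a) (hpb : p ≤ b) :
    negMulLog p ≤ p * -log a + p * -log b + a * b := by
  rcases hp.eq_or_lt with rfl | hp
  · simpa using mul_nonneg hpa hpb
  have ha : 0 < a := hp.trans_le hpa
  have hb : 0 < b := hp.trans_le hpb
  have h := log_le_sub_one_of_pos (div_pos (mul_pos ha hb) hp)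
  rw [log_div (mul_pos ha hb).ne' hp.ne', log_mul ha.ne' hb.ne'] at h
  have h' := mul_le_mul_of_nonneg_left h hp.le
  rw [mul_sub p (a * b / p), mul_div_cancel₀ _ hp.ne'] at h'
  rw [negMulLog]
  linarith

section Entropy

variable {X ι κ : Type*} [MeasurableSpace X] {μ : Measure X} [Countable ι] [Countable κ]

lemma Hent_comp_injective (f : X → ι) {e : ι → κ} (he : e.Injective) :
    Hent μ (fun x => e (f x)) = Hent μ f := by
  unfold Hent
  rw [← he.tsum_eq]
  · refine tsum_congr fun i => ?_
    congr 4
    ext x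
    simp [he.eq_iff]
  · intro k hk
    by_contra hne
    apply hk
    have : (fun x => e (f x)) ⁻¹' {k} = ∅ := by
      ext x
      simp only [Set.mem_preimage, Set.mem_singleton_iff, Set.mem_empty_iff_false, iff_false]
      exact fun h => hne ⟨f x, h⟩
    simp [this]

lemma tsum_measure_inter_preimage_singleton [MeasurableSpace ι] [MeasurableSingletonClass ι]
    {f : X → ι} (hf : Measurable f) {s : Set X} (hs : MeasurableSet s) :
    ∑' i, μ (s ∩ f ⁻¹' {i}) = μ s := by
  rw [← measure_iUnion]
  · rw [← Set.inter_iUnion, ← Set.preimage_iUnion, Set.iUnion_of_singleton, Set.preimage_univ,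
      Set.inter_univ]
  · intro i j hij
    refine Set.disjoint_left.2 fun x hx hx' => hij ?_
    exact hx.2.symm.trans hx'.2
  · exact fun i => hs.inter (hf (measurableSet_singleton i))

lemma Hent_comp_measurePreserving [MeasurableSpace ι] [MeasurableSingletonClass ι]
    {f : X → ι} (hf : Measurable f) {S : X → X} (hS : MeasurePreserving S μ μ) :
    Hent μ (fun x => f (S x)) = Hent μ f := by
  unfold Hent
  refine tsum_congr fun i => ?_
  rw [← hS.measure_preimage (hf (measurableSet_singleton i)).nullMeasurableSet]
  rfl

lemma ofReal_negMulLog_measure [IsProbabilityMeasure μ] (s : Set X) :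
    ENNReal.ofReal (Real.negMulLog (μ s).toReal) =
      μ s * ENNReal.ofReal (-Real.log (μ s).toReal) := by
  rw [Real.negMulLog, neg_mul_comm, ENNReal.ofReal_mul ENNReal.toReal_nonneg,
    ENNReal.ofReal_toReal (measure_ne_top μ s)]

/-- The entropy of a join is subadditive up to a constant. -/
lemma Hent_prodMk_le [IsProbabilityMeasure μ] [MeasurableSpace ι] [MeasurableSingletonClass ι]
    [MeasurableSpace κ] [MeasurableSingletonClass κ]
    {f : X → ι} {g : X → κ} (hf : Measurable f) (hg : Measurable g) :
    Hent μ (fun x => (f x, g x)) ≤ Hent μ f + Hent μ g + 1 := by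
  have hfs (i : ι) : MeasurableSet (f ⁻¹' {i}) := hf (measurableSet_singleton i)
  have hgs (k : κ) : MeasurableSet (g ⁻¹' {k}) := hg (measurableSet_singleton k)
  have hterm (i : ι) (k : κ) :
      ENNReal.ofReal (Real.negMulLog (μ ((fun x => (f x, g x)) ⁻¹' {(i, k)})).toReal) ≤
        μ (f ⁻¹' {i} ∩ g ⁻¹' {k}) * ENNReal.ofReal (-Real.log (μ (f ⁻¹' {i})).toReal) +
        μ (g ⁻¹' {k} ∩ f ⁻¹' {i}) * ENNReal.ofReal (-Real.log (μ (g ⁻¹' {k})).toReal) +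
        μ (f ⁻¹' {i}) * μ (g ⁻¹' {k}) := by
    have hset : (fun x => (f x, g x)) ⁻¹' {(i, k)} = f ⁻¹' {i} ∩ g ⁻¹' {k} := by
      ext x
      simp
    rw [hset, Set.inter_comm (g ⁻¹' {k})]
    have h := negMulLog_le_of_le_marginals
      (p := (μ (f ⁻¹' {i} ∩ g ⁻¹' {k})).toReal) ENNReal.toReal_nonneg
      (ENNReal.toReal_mono (measure_ne_top μ _) (measure_mono Set.inter_subset_left))
      (ENNReal.toReal_mono (measure_ne_top μ _) (measure_mono Set.inter_subset_right))
    refine (ENNReal.ofReal_le_ofReal h).trans ?_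
    refine ENNReal.ofReal_add_le.trans (add_le_add (ENNReal.ofReal_add_le.trans ?_) ?_)
    · rw [ENNReal.ofReal_mul ENNReal.toReal_nonneg, ENNReal.ofReal_mul ENNReal.toReal_nonneg,
        ENNReal.ofReal_toReal (measure_ne_top μ _)]
    · rw [ENNReal.ofReal_mul ENNReal.toReal_nonneg, ENNReal.ofReal_toReal (measure_ne_top μ _),
        ENNReal.ofReal_toReal (measure_ne_top μ _)]
  have hsum_f : ∑' i, μ (f ⁻¹' {i}) = 1 := by
    simpa using tsum_measure_inter_preimage_singleton (μ := μ) hf MeasurableSet.univ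
  have hsum_g : ∑' k, μ (g ⁻¹' {k}) = 1 := by
    simpa using tsum_measure_inter_preimage_singleton (μ := μ) hg MeasurableSet.univ
  calc Hent μ (fun x => (f x, g x))
      = ∑' i, ∑' k,
          ENNReal.ofReal (Real.negMulLog (μ ((fun x => (f x, g x)) ⁻¹' {(i, k)})).toReal) :=
        ENNReal.tsum_prod (f := fun i k =>
          ENNReal.ofReal (Real.negMulLog (μ ((fun x => (f x, g x)) ⁻¹' {(i, k)})).toReal))
    _ ≤ _ := ENNReal.tsum_le_tsum fun i => ENNReal.tsum_le_tsum fun k => hterm i k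
    _ = Hent μ f + Hent μ g + 1 := by
      simp only [ENNReal.tsum_add]
      congr 1
      · congr 1
        · simp only [ENNReal.tsum_mul_right, tsum_measure_inter_preimage_singleton hg (hfs _)]
          exact tsum_congr fun i => (ofReal_negMulLog_measure _).symm
        · rw [ENNReal.tsum_comm]
          simp only [ENNReal.tsum_mul_right, tsum_measure_inter_preimage_singleton hf (hgs _)]
          exact tsum_congr fun i => (ofReal_negMulLog_measure _).symm
      · simp only [ENNReal.tsum_mul_left, hsum_g, mul_one, hsum_f]

end Entropy

section Action

variable {Γ X : Type*} [MeasurableSpace X] {μ : Measure X} {T : Γ → X → X}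

lemma measurable_join (hT : ∀ g, Measurable (T g)) {f : X → ℕ} (hf : Measurable f)
    (W : Finset Γ) : Measurable (fun x (w : W) => f (T (w : Γ) x)) :=
  measurable_pi_lambda _ fun w => hf.comp (hT w)

lemma Hent_join_lt_top [IsProbabilityMeasure μ] (hT : ∀ g, MeasurePreserving (T g) μ μ)
    {f : X → ℕ} (hf : Measurable f) (hfin : Hent μ f < ⊤) (W : Finset Γ) :
    Hent μ (fun x (w : W) => f (T (w : Γ) x)) < ⊤ := by
  classical
  induction W using Finset.induction_on with
  | empty =>
    have h := Hent_comp_injective (μ := μ) (fun x (w : (∅ : Finset Γ)) => f (T (w : Γ) x))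
      (e := fun _ => ()) (Function.injective_of_subsingleton _)
    rw [← h]
    simp [Hent]
  | insert a W _ ih =>
    let e : (↥(insert a W : Finset Γ) → ℕ) → ℕ × (W → ℕ) := fun φ =>
      (φ ⟨a, Finset.mem_insert_self a W⟩, fun w => φ ⟨w, Finset.mem_insert_of_mem w.2⟩)
    have he : e.Injective := by
      intro φ ψ h
      ext ⟨w, hw⟩
      rcases Finset.mem_insert.1 hw with rfl | hw'
      · exact congrArg Prod.fst h
      · exact congrFun (congrArg Prod.snd h) ⟨w, hw'⟩
    rw [← Hent_comp_injective _ he]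
    refine (Hent_prodMk_le (hf.comp (hT a).measurable)
      (measurable_join (fun g => (hT g).measurable) hf W)).trans_lt ?_
    have ha : Hent μ (f ∘ T a) = Hent μ f := Hent_comp_measurePreserving hf (hT a)
    rw [ha]
    exact ENNReal.add_lt_top.2 ⟨ENNReal.add_lt_top.2 ⟨hfin, ih⟩, ENNReal.one_lt_top⟩

/-- Passing to the join over an `r`-expanding set multiplies naive entropy by at least `r`. -/
lemma mul_naiveEntPart_le_join [Group Γ] [DecidableEq Γ]
    (hTmul : ∀ g h x, T (g * h) x = T g (T h x)) (f : X → ℕ) {W : Finset Γ} (hW : W.Nonempty)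
    {r : ℝ≥0∞} (hr : ∀ F : Finset Γ, F.Nonempty → r * F.card ≤ (W * F).card)
    {e : (W → ℕ) → ℕ} (he : e.Injective) :
    r * naiveEntPart μ T f ≤ naiveEntPart μ T (fun x => e fun w => f (T (w : Γ) x)) := by
  refine le_iInf fun ⟨F, hF⟩ => ?_
  have hF0 : (F.card : ℝ≥0∞) ≠ 0 := by simpa using hF.ne_empty
  rw [ENNReal.le_div_iff_mul_le (.inl hF0) (.inl (ENNReal.natCast_ne_top _))]
  let E : (↥(W * F) → ℕ) → F → ℕ := fun φ h =>
    e fun w => φ ⟨w * h, Finset.mul_mem_mul w.2 h.2⟩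
  have hE : E.Injective := by
    intro φ ψ hφψ
    ext ⟨g, hg⟩
    obtain ⟨w, hw, h, hh, rfl⟩ := Finset.mem_mul.1 hg
    exact congrFun (he (congrFun hφψ ⟨h, hh⟩)) ⟨w, hw⟩
  have hjoin : Hent μ (fun x (h : F) => e fun w : W => f (T (w : Γ) (T (h : Γ) x))) =
      Hent μ (fun x (g : (W * F : Finset Γ)) => f (T (g : Γ) x)) := by
    rw [← Hent_comp_injective _ hE]
    simp only [E, hTmul]
  have hWF : (W * F).Nonempty := hW.mul hF
  have hWF0 : ((W * F).card : ℝ≥0∞) ≠ 0 := by simpa using hWF.ne_empty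
  have hle : naiveEntPart μ T f ≤ _ := iInf_le _ ⟨W * F, hWF⟩
  rw [ENNReal.le_div_iff_mul_le (.inl hWF0) (.inl (ENNReal.natCast_ne_top _))] at hle
  calc r * naiveEntPart μ T f * F.card = naiveEntPart μ T f * (r * F.card) := by ring
    _ ≤ naiveEntPart μ T f * (W * F).card := by gcongr; exact hr F hF
    _ ≤ _ := hle
    _ = _ := hjoin.symm

end Action

/-- If `Γ` is a countable non-amenable group (characterized by: for every `r > 0` there
is a finite `W ⊆ Γ` with `|WF| > r·|F|` for all finite nonempty `F`), then for any pmp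
action of `Γ` the naive entropy is either `0` or `+∞`; more precisely, if some
finite-Shannon-entropy partition has positive naive entropy, then the naive entropy of
the action is `+∞`. -/
theorem stmt_5 {Γ : Type*} [Group Γ] [Countable Γ] [DecidableEq Γ]
    {X : Type*} [MeasurableSpace X] (μ : Measure X) [IsProbabilityMeasure μ]
    (T : Γ → X → X) (hTmp : ∀ g, MeasurePreserving (T g) μ μ)
    (hT1 : ∀ x, T 1 x = x) (hTmul : ∀ g h x, T (g * h) x = T g (T h x))
    (hnonamen : ∀ r : ℝ, 0 < r → ∃ W : Finset Γ,
      ∀ F : Finset Γ, F.Nonempty → r * (F.card : ℝ) < ((W * F).card : ℝ)) :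
    ((⨆ (f : X → ℕ) (_ : Measurable f) (_ : Hent μ f < ⊤), naiveEntPart μ T f) = 0 ∨
      (⨆ (f : X → ℕ) (_ : Measurable f) (_ : Hent μ f < ⊤), naiveEntPart μ T f) = ⊤) ∧
    (∀ f : X → ℕ, Measurable f → Hent μ f < ⊤ → 0 < naiveEntPart μ T f →
      (⨆ (f : X → ℕ) (_ : Measurable f) (_ : Hent μ f < ⊤), naiveEntPart μ T f) = ⊤) := by
  have hpos : ∀ f : X → ℕ, Measurable f → Hent μ f < ⊤ → 0 < naiveEntPart μ T f →
      (⨆ (f : X → ℕ) (_ : Measurable f) (_ : Hent μ f < ⊤), naiveEntPart μ T f) = ⊤ := by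
    intro f hf hfin hf0
    by_contra hne
    obtain ⟨n, hn⟩ := ENNReal.exists_nat_mul_gt hf0.ne' hne
    obtain ⟨W, hW⟩ := hnonamen (n + 1) (by positivity)
    have hWne : W.Nonempty := by
      rw [Finset.nonempty_iff_ne_empty]
      rintro rfl
      have h := hW {1} (Finset.singleton_nonempty 1)
      simp only [Finset.empty_mul, Finset.card_empty, Finset.card_singleton] at h
      push_cast at h
      linarith [(Nat.cast_nonneg n : (0 : ℝ) ≤ n)]
    obtain ⟨e, he⟩ := exists_injective_nat (W → ℕ)
    have hr (F : Finset Γ) (hF : F.Nonempty) : (n : ℝ≥0∞) * F.card ≤ (W * F).card := by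
      have h : ((n + 1) * F.card : ℕ) < (W * F).card := by exact_mod_cast hW F hF
      exact_mod_cast (Nat.mul_le_mul_right _ n.le_succ).trans h.le
    refine hn.not_ge ((mul_naiveEntPart_le_join hTmul f hWne hr he).trans ?_)
    refine le_iSup_of_le (fun x => e fun w : W => f (T (w : Γ) x)) (le_iSup_of_le ?_
      (le_iSup_of_le ?_ le_rfl))
    · exact (Measurable.of_discrete (f := e)).comp
        (measurable_join (fun g => (hTmp g).measurable) hf W)
    · rw [Hent_comp_injective _ he]
      exact Hent_join_lt_top hTmp hf hfin W
  refine ⟨or_iff_not_imp_left.2 fun h0 => ?_, hpos⟩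
  simp only [ENNReal.iSup_eq_zero, not_forall] at h0
  obtain ⟨f, hf, hfin, hne⟩ := h0
  exact hpos f hf hfin (pos_iff_ne_zero.2 hne)
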